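/- Assume Setup (T). Then P ∗ (p^m · P^k) = 0 for all k ∈ ℤ, where P^k is the k-th power of P in (A,∘) and p^m · x denotes the p^m-fold additive multiple of x. -/

import Mathlib

/-- A (left) brace: an abelian group `(A,+)` and a group `(A,∘)` (written `*`)
on the same underlying set, with `a∘(b+c)+a = a∘b+a∘c`; the identity of `(A,∘)`
coincides with `0`. -/
class Brace (A : Type*) extends AddCommGroup A, Group A where
  mul_add_left : ∀ a b c : A, a * (b + c) + a = a * b + a * c
  one_eq_zero : (1 : A) = 0

namespace Brace

variable {A : Type*} [Brace A]

/-- The star operation `a ∗ b = a∘b - a - b`. -/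
def bstar (a b : A) : A := a * b - a - b

/-- `X ∗ Y`: the additive subgroup generated by `{x∗y : x ∈ X, y ∈ Y}`. -/
def starSpan (A : Type*) [Brace A] (X Y : Set A) : AddSubgroup A :=
  AddSubgroup.closure {z : A | ∃ x ∈ X, ∃ y ∈ Y, z = bstar x y}

/-- `A² = A ∗ A`. -/
def sq (A : Type*) [Brace A] : AddSubgroup A := starSpan A Set.univ Set.univ

/-- `A³ = A ∗ A²`. -/
def cube (A : Type*) [Brace A] : AddSubgroup A := starSpan A Set.univ (sq A : Set A)

/-- The right series: `rightSeries A 0 = A^(1) = A`, `rightSeries A (n+1) = A^(n+1+1) = A^(n+1) ∗ A`. -/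
def rightSeries (A : Type*) [Brace A] : ℕ → AddSubgroup A
  | 0 => ⊤
  | n + 1 => starSpan A (rightSeries A n : Set A) Set.univ

/-- A brace is right nilpotent if `A^(n) = 0` for some `n`. -/
def RightNilpotent (A : Type*) [Brace A] : Prop := ∃ n : ℕ, rightSeries A n = ⊥

/-- `c ∈ Z(A)`: `c∗a = a∗c` for all `a`. -/
def IsCentral (c : A) : Prop := ∀ a : A, bstar c a = bstar a c

end Brace

/-- Setup (T) of the paper: `p > 5` prime, `A` a brace of cardinality `p^4` whose additive
group is `C_p × C_{p^3}` (with `m = 2`) or `C_{p^2} × C_{p^2}` (with `m = 1`), whose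
multiplicative group is generated by `{P, Q_1, …, Q_i}`, with `P^{p^m}` central and in `A²`,
each `Q_j` of order at most `p^m`, and every `a ∈ A` writable as
`P^k ∘ Q_{σ(1)}^{a_{σ(1)}} ∘ ⋯ ∘ Q_{σ(i)}^{a_{σ(i)}}` for every ordering `σ`. -/
structure SetupT (p m i : ℕ) (A : Type*) [Brace A] (P : A) (Q : Fin i → A) : Prop where
  hp : p.Prime
  hp5 : 5 < p
  hcard : Nat.card A = p ^ 4
  hadd : (Nonempty (A ≃+ ZMod p × ZMod (p ^ 3)) ∧ m = 2) ∨
         (Nonempty (A ≃+ ZMod (p ^ 2) × ZMod (p ^ 2)) ∧ m = 1)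
  hgen : Subgroup.closure ({P} ∪ Set.range Q) = ⊤
  hcentral : Brace.IsCentral (P ^ (p ^ m))
  hsq : P ^ (p ^ m) ∈ Brace.sq A
  hord : ∀ j : Fin i, orderOf (Q j) ≤ p ^ m
  hdecomp : ∀ a : A, ∀ σ : Equiv.Perm (Fin i), ∃ (k : ℤ) (e : Fin i → ℤ),
      a = P ^ k * (List.ofFn fun t : Fin i => Q (σ t) ^ e (σ t)).prod

namespace Brace

section EndRing

variable {A : Type*} [AddCommGroup A]

theorem natCast_card_end_eq_zero [Finite A] : ((Nat.card A : ℕ) : AddMonoid.End A) = 0 := by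
  ext x
  simp [AddMonoid.End.natCast_apply]

/-- A unipotent-order argument: if `N + 1` has `p`-power order and `p ^ n` kills the ring,
then `N` is nilpotent. -/
theorem isNilpotent_of_add_one_pow_eq_one {R : Type*} [Ring R] {p n k : ℕ} (hp : p.Prime)
    (hR : ((p ^ n : ℕ) : R) = 0) {N : R} (hN : (N + 1) ^ p ^ k = 1) : IsNilpotent N := by
  obtain ⟨r, hr⟩ := (Commute.one_right N).exists_add_pow_prime_pow_eq hp k
  rw [hN, one_pow] at hr
  have h1 : N ^ p ^ k = -((p : R) * (N * 1 * r)) := by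
    rw [eq_neg_iff_add_eq_zero]
    have h2 : N ^ p ^ k + 1 + (p : R) * N * 1 * r - 1 = 0 := by rw [← hr, sub_self]
    rw [← h2]
    noncomm_ring
  refine ⟨p ^ k * n, ?_⟩
  rw [pow_mul, h1, neg_pow, (Nat.cast_commute p _).mul_pow, ← Nat.cast_pow, hR]
  simp

/-- A nilpotent endomorphism of an abelian group of order `p ^ n` has nilpotency index at most
`n`. -/
theorem end_pow_eq_zero_of_isNilpotent [Finite A] {p n : ℕ} (hp : p.Prime)
    (hA : Nat.card A = p ^ n) {N : AddMonoid.End A} (hN : IsNilpotent N) : N ^ n = 0 := by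
  have key : ∀ j ≤ n, Nat.card (AddMonoidHom.range (N ^ j)) ∣ p ^ (n - j) := by
    intro j
    induction j with
    | zero =>
      intro _
      rw [Nat.sub_zero, ← hA]
      exact AddSubgroup.card_addSubgroup_dvd_card _
    | succ j ih =>
      intro hj
      have hle : AddMonoidHom.range (N ^ (j + 1)) ≤ AddMonoidHom.range (N ^ j) := by
        rintro _ ⟨x, rfl⟩
        exact ⟨N x, by rw [pow_succ]; rfl⟩
      by_cases heq : AddMonoidHom.range (N ^ (j + 1)) = AddMonoidHom.range (N ^ j)
      · obtain ⟨k, hk⟩ := hN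
        have hst : ∀ t, AddMonoidHom.range (N ^ j) ≤ AddMonoidHom.range (N ^ (t + j)) := by
          intro t
          induction t with
          | zero => simp
          | succ t iht =>
            intro x hx
            rw [← heq] at hx
            obtain ⟨y, rfl⟩ := hx
            obtain ⟨z, hz⟩ := iht ⟨y, rfl⟩
            refine ⟨z, ?_⟩
            calc (N ^ (t + 1 + j)) z = N ((N ^ (t + j)) z) := by
                  rw [show t + 1 + j = (t + j) + 1 by ring, pow_succ']; rfl
              _ = N ((N ^ j) y) := congrArg N hz
              _ = (N ^ (j + 1)) y := by rw [pow_succ']; rfl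
        have hbot : AddMonoidHom.range (N ^ (j + 1)) = ⊥ := by
          rw [heq, eq_bot_iff]
          refine (hst k).trans ?_
          rintro _ ⟨x, rfl⟩
          rw [pow_add, hk, zero_mul]
          rfl
        rw [hbot]
        simp
      · obtain ⟨s, hs, hsc⟩ := (Nat.dvd_prime_pow hp).1 (ih (by omega))
        obtain ⟨t, ht, htc⟩ := (Nat.dvd_prime_pow hp).1
          ((AddSubgroup.card_dvd_of_le hle).trans (dvd_of_eq hsc))
        rw [htc]
        refine pow_dvd_pow p ?_
        have hne : t ≠ s := by
          rintro rfl
          exact heq (AddSubgroup.eq_of_le_of_card_ge hle (by rw [htc, hsc]))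
        omega
  have h1 := key n le_rfl
  rw [Nat.sub_self, pow_zero, Nat.dvd_one, AddSubgroup.card_eq_one] at h1
  ext x
  have h2 : (N ^ n) x ∈ AddMonoidHom.range (N ^ n) := ⟨x, rfl⟩
  rw [h1] at h2
  exact h2

/-- If `N ^ (p - 1) = 0`, then `∑_{i < p} (N + 1) ^ i` is `p` times a unit. -/
theorem exists_isUnit_geom_sum_eq {R : Type*} [Ring R] {p : ℕ} (hp : p.Prime) {N : R}
    (hN : N ^ (p - 1) = 0) :
    ∃ u : R, IsUnit u ∧ ∑ i ∈ Finset.range p, (N + 1) ^ i = u * (p : R) := by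
  have hp1 : 1 ≤ p - 1 := by have := hp.two_le; omega
  have hsum : ∑ i ∈ Finset.range p, (N + 1) ^ i
      = ∑ i ∈ Finset.range p, (p.choose (i + 1) : R) * N ^ i := by
    have h := congrArg (Polynomial.aeval N)
      (Polynomial.geom_sum_X_comp_X_add_one_eq_sum (R := ℤ) p)
    rw [Polynomial.aeval_comp] at h
    simpa [map_sum] using h
  let w : R := ∑ i ∈ Finset.range (p - 2), ((p.choose (i + 2) / p : ℕ) : R) * N ^ i
  refine ⟨N * w + 1, ?_, ?_⟩
  · have hc : Commute N w := Commute.sum_right _ _ _ fun i _ =>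
      ((Nat.cast_commute _ N).symm).mul_right (Commute.self_pow N i)
    exact (hc.isNilpotent_mul_right ⟨_, hN⟩).isUnit_add_one
  · obtain ⟨q, rfl⟩ : ∃ q, p = q + 2 := ⟨p - 2, by omega⟩
    simp only [show q + 2 - 1 = q + 1 by omega] at hN w ⊢
    rw [hsum, Finset.sum_range_succ, hN, mul_zero, add_zero, Finset.sum_range_succ']
    rw [add_mul, Finset.mul_sum, Finset.sum_mul]
    congr 1
    · refine Finset.sum_congr rfl fun i hi => ?_
      have hi' := Finset.mem_range.1 hi
      have hd : q + 2 ∣ (q + 2).choose (i + 2) :=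
        hp.dvd_choose_self (by omega) (by omega)
      obtain ⟨d, hd⟩ := hd
      rw [show i + 1 + 1 = i + 2 by ring, hd, Nat.mul_div_cancel_left d (by omega),
        pow_succ', Nat.cast_mul, ← (Nat.cast_commute (q + 2) (N * _)).eq, mul_assoc,
        (Nat.cast_commute d N).left_comm]
    · simp

end EndRing

variable {A : Type*} [Brace A]

/-- The action `λ_a(b) = a∘b - a` of `(A,∘)` on `(A,+)`. -/
def lam : A →* AddMonoid.End A where
  toFun a :=
    { toFun := fun b => a * b - a
      map_zero' := by rw [← one_eq_zero, mul_one, sub_self]; exact one_eq_zero.symm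
      map_add' := fun b c => by
        have := mul_add_left a b c
        rw [eq_sub_of_add_eq this]
        abel }
  map_one' := by
    ext b
    change 1 * b - 1 = b
    rw [one_mul, one_eq_zero, sub_zero]
  map_mul' a b := by
    ext c
    change a * b * c - a * b = a * (b * c - b) - a
    have := mul_add_left a (b * c - b) b
    rw [sub_add_cancel, ← mul_assoc] at this
    rw [sub_eq_sub_iff_add_eq_add, this, add_comm]

theorem lam_apply (a b : A) : lam a b = a * b - a := rfl

theorem mul_eq_add_lam (a b : A) : a * b = a + lam a b := by
  rw [lam_apply]; abel

theorem bstar_eq (a b : A) : bstar a b = (lam a - 1) b := by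
  change a * b - a - b = lam a b - b
  rw [lam_apply]

theorem pow_eq_geom_sum (a : A) (n : ℕ) :
    a ^ n = (∑ i ∈ Finset.range n, lam a ^ i) a := by
  induction n with
  | zero => rw [pow_zero, Finset.sum_range_zero, one_eq_zero]; rfl
  | succ n ih =>
    rw [pow_succ, mul_eq_add_lam, Finset.sum_range_succ, map_pow]
    conv_lhs => rw [ih]
    rfl

theorem isNilpotent_lam_sub_one [Finite A] {p n : ℕ} (hp : p.Prime) (hA : Nat.card A = p ^ n)
    (a : A) : IsNilpotent (lam a - 1) := by
  refine isNilpotent_of_add_one_pow_eq_one (n := n) (k := n) hp ?_ ?_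
  · rw [← hA]; exact natCast_card_end_eq_zero
  · rw [sub_add_cancel, ← map_pow, ← hA, pow_card_eq_one', map_one]

/-- In a brace of order `p ^ n` with `n < p`, the `p`-th power of `a` in `(A,∘)` is the image of
`p • a` under an additive automorphism. -/
theorem exists_isUnit_pow_prime_eq [Finite A] {p n : ℕ} (hp : p.Prime) (hn : n < p)
    (hA : Nat.card A = p ^ n) (a : A) :
    ∃ u : AddMonoid.End A, IsUnit u ∧ a ^ p = u (p • a) := by
  have h0 : (lam a - 1) ^ (p - 1) = 0 :=
    pow_eq_zero_of_le (by omega)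
      (end_pow_eq_zero_of_isNilpotent hp hA (isNilpotent_lam_sub_one hp hA a))
  obtain ⟨u, hu, hs⟩ := exists_isUnit_geom_sum_eq hp h0
  refine ⟨u, hu, ?_⟩
  rw [sub_add_cancel] at hs
  rw [pow_eq_geom_sum, hs]
  change u ((p : AddMonoid.End A) a) = _
  rw [AddMonoid.End.natCast_apply]

/-- The additive `n`-torsion, as a subgroup of `(A,∘)`. -/
def torsionSubgroup (A : Type*) [Brace A] (n : ℕ) : Subgroup A where
  carrier := {x | n • x = 0}
  one_mem' := by
    change n • (1 : A) = 0
    rw [one_eq_zero, smul_zero]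
  mul_mem' {a b} ha hb := by
    change n • (a * b) = 0
    change n • a = 0 at ha
    change n • b = 0 at hb
    rw [mul_eq_add_lam, smul_add, ha, ← map_nsmul, hb, map_zero, add_zero]
  inv_mem' {a} ha := by
    change n • a⁻¹ = 0
    change n • a = 0 at ha
    have h := mul_eq_add_lam a⁻¹ a
    rw [inv_mul_cancel, one_eq_zero] at h
    rw [eq_neg_of_add_eq_zero_left h.symm, smul_neg, ← map_nsmul, ha, map_zero, neg_zero]

theorem mem_torsionSubgroup {n : ℕ} {x : A} : x ∈ torsionSubgroup A n ↔ n • x = 0 := Iff.rfl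

/-- An element of order at most `p` in a brace of order `p ^ n`, `n < p`, is additively
`p`-torsion. -/
theorem mem_torsionSubgroup_of_orderOf_le [Finite A] {p n : ℕ} (hp : p.Prime) (hn : n < p)
    (hA : Nat.card A = p ^ n) {x : A} (hx : orderOf x ≤ p) : x ∈ torsionSubgroup A p := by
  have h1 : x ^ p = 1 := by
    obtain ⟨t, -, ht⟩ := (Nat.dvd_prime_pow hp).1 (hA ▸ orderOf_dvd_natCard x)
    rw [← orderOf_dvd_iff_pow_eq_one, ht]
    rw [ht] at hx
    have : t ≤ 1 := (Nat.pow_le_pow_iff_right hp.one_lt).1 (by simpa using hx)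
    simpa using pow_dvd_pow p this
  obtain ⟨u, hu, hux⟩ := exists_isUnit_pow_prime_eq hp hn hA x
  obtain ⟨v, hv⟩ := hu.exists_left_inv
  calc p • x = (v * u) (p • x) := by rw [hv]; rfl
    _ = v (u (p • x)) := rfl
    _ = 0 := by rw [← hux, h1, one_eq_zero, map_zero]

/-- `p`-torsion elements of `ZMod (p ^ 2)` are multiples `p * b` with `b < p`. -/
theorem exists_fin_eq_mul_of_nsmul_eq_zero {p : ℕ} (hp : p.Prime) {x : ZMod (p ^ 2)}
    (hx : p • x = 0) : ∃ b : Fin p, x = ((p * b : ℕ) : ZMod (p ^ 2)) := by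
  have : NeZero (p ^ 2) := ⟨pow_ne_zero _ hp.ne_zero⟩
  obtain ⟨y, hy, rfl⟩ : ∃ y : ℕ, y < p ^ 2 ∧ (y : ZMod (p ^ 2)) = x :=
    ⟨x.val, x.val_lt, ZMod.natCast_zmod_val x⟩
  rw [nsmul_eq_mul, ← Nat.cast_mul, ZMod.natCast_eq_zero_iff, pow_two] at hx
  obtain ⟨b, rfl⟩ := Nat.dvd_of_mul_dvd_mul_left hp.pos hx
  exact ⟨⟨b, by nlinarith [hp.pos]⟩, rfl⟩

/-- If every element of a brace of order `p ^ 4`, `5 < p`, is a power of `P` times a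
`p`-torsion element, then the additive group is not `C_{p ^ 2} × C_{p ^ 2}`. -/
theorem isEmpty_addEquiv_of_cyclic_mul_torsion {p : ℕ} (hp : p.Prime) (hp5 : 5 < p)
    (hA : Nat.card A = p ^ 4) (P : A)
    (hdec : ∀ a : A, ∃ k : ℤ, ∃ s ∈ torsionSubgroup A p, a = P ^ k * s) :
    IsEmpty (A ≃+ ZMod (p ^ 2) × ZMod (p ^ 2)) := by
  refine ⟨fun e => ?_⟩
  have : Finite A := Nat.finite_of_card_ne_zero (by rw [hA]; exact pow_ne_zero _ hp.ne_zero)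
  have hPp : P ^ p ∈ torsionSubgroup A p := by
    obtain ⟨u, -, hu⟩ := exists_isUnit_pow_prime_eq hp (by omega) hA P
    rw [mem_torsionSubgroup, hu, ← map_nsmul, ← mul_smul, ← pow_two]
    have : p ^ 2 • P = 0 := by
      apply e.injective
      rw [map_nsmul, map_zero]
      have h0 : ((p : ZMod (p ^ 2))) ^ 2 = 0 := by exact_mod_cast ZMod.natCast_self (p ^ 2)
      ext <;> simp [nsmul_eq_mul, h0]
    rw [this, map_zero]
  let f : Fin p × Fin p × Fin p → A := fun t =>
    P ^ (t.1 : ℕ) * e.symm (((p * t.2.1 : ℕ) : ZMod (p ^ 2)), ((p * t.2.2 : ℕ) : ZMod (p ^ 2)))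
  have hf : Function.Surjective f := by
    intro a
    obtain ⟨k, s, hs, rfl⟩ := hdec a
    have hpos : (0 : ℤ) < p := by exact_mod_cast hp.pos
    obtain ⟨r, hr⟩ := Int.eq_ofNat_of_zero_le (Int.emod_nonneg k hpos.ne')
    have hrp : r < p := by
      have := Int.emod_lt_of_pos k hpos
      omega
    have hs' : (P ^ p) ^ (k / p) * s ∈ torsionSubgroup A p :=
      mul_mem (zpow_mem hPp _) hs
    rw [mem_torsionSubgroup] at hs'
    have he : p • e ((P ^ p) ^ (k / p) * s) = 0 := by rw [← map_nsmul, hs', map_zero]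
    obtain ⟨b, hb⟩ := exists_fin_eq_mul_of_nsmul_eq_zero hp (congrArg Prod.fst he)
    obtain ⟨c, hc⟩ := exists_fin_eq_mul_of_nsmul_eq_zero hp (congrArg Prod.snd he)
    refine ⟨(⟨r, hrp⟩, b, c), ?_⟩
    change P ^ r * e.symm (((p * b : ℕ) : ZMod (p ^ 2)), ((p * c : ℕ) : ZMod (p ^ 2))) = _
    rw [← hb, ← hc, Prod.mk.eta, AddEquiv.symm_apply_apply, ← mul_assoc, ← zpow_natCast P r,
      ← zpow_natCast P p, ← zpow_mul, ← zpow_add, ← hr,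
      Int.emod_add_mul_ediv]
  have hle := Nat.card_le_card_of_surjective f hf
  simp only [hA, Nat.card_prod, Nat.card_fin] at hle
  have h3 : p * (p * p) = p ^ 3 := by ring
  rw [h3, Nat.pow_le_pow_iff_right hp.one_lt] at hle
  omega

/-- A nilpotent endomorphism vanishes on `p ^ 2 • A` when `A ≅ C_p × C_{p ^ 3}`. -/
theorem end_apply_sq_smul_eq_zero {B : Type*} [AddCommGroup B] {p : ℕ} (hp : p.Prime)
    (e : B ≃+ ZMod p × ZMod (p ^ 3)) {N : AddMonoid.End B} (hN : IsNilpotent N) (b : B) :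
    N (p ^ 2 • b) = 0 := by
  have hz : ∀ b : B, ∃ t : ℤ, p ^ 2 • b = t • p ^ 2 • e.symm (0, 1) := by
    intro b
    obtain ⟨t, ht⟩ := ZMod.intCast_surjective (e b).2
    refine ⟨t, e.injective ?_⟩
    rw [map_nsmul, map_zsmul, map_nsmul, AddEquiv.apply_symm_apply]
    ext
    · simp
    · simp [← ht, mul_comm]
  have hpz : (p : ℤ) • p ^ 2 • e.symm (0, 1) = 0 := by
    apply e.injective
    rw [map_zsmul, map_nsmul, AddEquiv.apply_symm_apply, map_zero]
    ext
    · simp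
    · have h := ZMod.natCast_self (p ^ 3)
      push_cast at h
      rw [Prod.smul_snd, Prod.smul_snd, Prod.snd_zero, nsmul_eq_mul, zsmul_eq_mul, mul_one]
      push_cast
      rw [← h]
      ring
  generalize hzdef : p ^ 2 • e.symm (0, 1) = z at hz hpz
  obtain ⟨t, ht⟩ : ∃ t : ℤ, N z = t • z := by
    rw [← hzdef, map_nsmul, hzdef]
    exact hz _
  have hNz : N z = 0 := by
    obtain ⟨k, hk⟩ := hN
    have hpow : ∀ j : ℕ, (N ^ j) z = t ^ j • z := by
      intro j
      induction j with
      | zero => simp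
      | succ j ih =>
        rw [pow_succ']
        change N ((N ^ j) z) = _
        rw [ih, map_zsmul, ht, ← mul_smul, ← pow_succ]
    have htk : t ^ k • z = 0 := by rw [← hpow, hk]; rfl
    by_cases hd : (p : ℤ) ∣ t
    · obtain ⟨s, rfl⟩ := hd
      rw [ht, mul_comm, mul_smul, hpz, smul_zero]
    · have hcop : IsCoprime (p : ℤ) (t ^ k) :=
        ((Nat.prime_iff_prime_int.1 hp).coprime_iff_not_dvd.2 hd).pow_right
      obtain ⟨x, y, hxy⟩ := hcop
      have : z = 0 := by
        rw [← one_smul ℤ z, ← hxy, add_smul, mul_smul, mul_smul, hpz, htk, smul_zero, smul_zero,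
          add_zero]
      rw [this, map_zero]
  obtain ⟨s, hs⟩ := hz b
  rw [hs, map_zsmul, hNz, smul_zero]

end Brace

/-- under Setup (T), P ∗ (p^m · P^k) = 0 for all k ∈ ℤ. -/
theorem setupT_star_pm_pow_eq_zero (p m i : ℕ) (A : Type*) [Brace A]
    (P : A) (Q : Fin i → A) (h : SetupT p m i A P Q) :
    ∀ k : ℤ, Brace.bstar P ((p ^ m) • (P ^ k)) = 0 := by
  intro k
  have hp := h.hp
  have hp5 := h.hp5
  have : Finite A := Nat.finite_of_card_ne_zero (by rw [h.hcard]; exact pow_ne_zero _ hp.ne_zero)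
  rcases h.hadd with ⟨⟨e⟩, rfl⟩ | ⟨⟨e⟩, rfl⟩
  · rw [Brace.bstar_eq]
    exact Brace.end_apply_sq_smul_eq_zero hp e (Brace.isNilpotent_lam_sub_one hp h.hcard P) _
  · refine ((Brace.isEmpty_addEquiv_of_cyclic_mul_torsion hp hp5 h.hcard P ?_).false e).elim
    intro a
    obtain ⟨k, f, ha⟩ := h.hdecomp a 1
    refine ⟨k, _, Subgroup.list_prod_mem _ ?_, ha⟩
    intro x hx
    obtain ⟨t, rfl⟩ := (List.mem_ofFn' _ _).1 hx
    refine zpow_mem (Brace.mem_torsionSubgroup_of_orderOf_le hp (by omega) h.hcard ?_) _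
    simpa using h.hord t
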